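/- For 0 < |z| < 1, the double contour integral B(z,z') := (z z'/2) ∫∫ ηξ log(−ξ+η) / ((e^{−ξ²/2} − z)(e^{−η²/2} − z')) dξ/(2πi) dη/(2πi), taken over vertical lines Re(ξ)=a, Re(η)=b with −√(−log|z|) < a < 0 < b < √(−log|z'|), equals the absolutely convergent double series (1/(4π)) Σ_{k,k'≥1} z^k (z')^{k'} / ((k+k')√(k k')). -/

import Mathlib

open Complex MeasureTheory

theorem integrable_of_norm_le_one_add_sq_mul_exp {f : ℝ → ℂ} (hf : AEStronglyMeasurable f volume)
    {C p : ℝ} (hp : 0 < p) (h : ∀ t, ‖f t‖ ≤ C * ((1 + t ^ 2) * Real.exp (-p * t ^ 2))) :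
    Integrable f := by
  have h1 := integrable_exp_neg_mul_sq hp
  have h2 := integrable_rpow_mul_exp_neg_mul_sq hp (s := 2) (by norm_num)
  have h3 := (h1.add h2).const_mul C
  refine h3.mono' hf (Filter.Eventually.of_forall fun t => (h t).trans (le_of_eq ?_))
  simp only [Pi.add_apply, Real.rpow_ofNat]
  ring

theorem norm_ofReal_add_mul_I_le (c t : ℝ) : ‖(c : ℂ) + t * I‖ ≤ |c| + |t| := by
  simpa using norm_add_le (c : ℂ) (t * I)

theorem add_abs_mul_add_abs_le {A B : ℝ} (hA : 0 ≤ A) (hB : 0 ≤ B) (t : ℝ) :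
    (A + |t|) * (B + |t|) ≤ (A + 1) * (B + 1) * (1 + t ^ 2) := by
  have h1 : |t| ≤ 1 + t ^ 2 := by nlinarith [sq_abs t, sq_nonneg (|t| - 1), abs_nonneg t]
  have h2 : |t| * |t| = t ^ 2 := by rw [← sq, sq_abs]
  have h3 := mul_le_mul_of_nonneg_left h1 (add_nonneg hA hB)
  nlinarith [mul_nonneg hA hB, sq_nonneg t, mul_nonneg (mul_nonneg hA hB) (sq_nonneg t)]

theorem norm_exp_quadratic_line (κ s c t : ℝ) :
    ‖cexp (κ * ((c : ℂ) + t * I) ^ 2 / 2 + s * ((c : ℂ) + t * I))‖ =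
      Real.exp (κ * c ^ 2 / 2 + s * c) * Real.exp (-(κ / 2) * t ^ 2) := by
  rw [norm_exp, ← Real.exp_add]
  congr 1
  have : (κ * ((c : ℂ) + t * I) ^ 2 / 2 + s * ((c : ℂ) + t * I)) =
      ((κ * (c ^ 2 - t ^ 2) / 2 + s * c : ℝ) : ℂ) + ((κ * c * t + s * t : ℝ) : ℂ) * I := by
    push_cast
    linear_combination (κ * (t : ℂ) ^ 2 / 2) * I_sq
  rw [this, add_re, ofReal_re, re_ofReal_mul, I_re]
  ring

theorem integral_exp_quadratic_line {κ : ℝ} (hκ : 0 < κ) (s c : ℝ) :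
    ∫ t : ℝ, cexp (κ * ((c : ℂ) + t * I) ^ 2 / 2 + s * ((c : ℂ) + t * I)) =
      Real.sqrt (2 * Real.pi / κ) * cexp (-s ^ 2 / (2 * κ)) := by
  have hκ' : (κ : ℂ) ≠ 0 := by exact_mod_cast hκ.ne'
  have h := integral_cexp_quadratic (b := ((-(κ / 2) : ℝ) : ℂ))
    (by rw [ofReal_re]; linarith) ((κ * c + s) * I) (κ * c ^ 2 / 2 + s * c)
  have e1 : ∀ t : ℝ, (κ * ((c : ℂ) + t * I) ^ 2 / 2 + s * ((c : ℂ) + t * I)) =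
      ((-(κ / 2) : ℝ) : ℂ) * t ^ 2 + ((κ * c + s) * I) * t + (κ * c ^ 2 / 2 + s * c) := by
    intro t
    push_cast
    linear_combination (κ * (t : ℂ) ^ 2 / 2) * I_sq
  simp_rw [e1]
  rw [h]
  congr 1
  · rw [Real.sqrt_eq_rpow, ofReal_cpow (by positivity)]
    congr 1
    · push_cast
      field_simp
    · simp
  · congr 1
    push_cast
    rw [mul_pow, I_sq]
    field_simp
    ring

theorem integrable_mul_exp_quadratic_line {κ : ℝ} (hκ : 0 < κ) (s c : ℝ) {P : ℝ → ℂ}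
    (hP : Measurable P) {C : ℝ} (hPC : ∀ t, ‖P t‖ ≤ C * (1 + t ^ 2)) :
    Integrable fun t : ℝ =>
      P t * cexp (κ * ((c : ℂ) + t * I) ^ 2 / 2 + s * ((c : ℂ) + t * I)) := by
  refine integrable_of_norm_le_one_add_sq_mul_exp (C := C * Real.exp (κ * c ^ 2 / 2 + s * c))
    (Measurable.aestronglyMeasurable (by fun_prop)) (half_pos hκ) fun t => ?_
  rw [norm_mul, norm_exp_quadratic_line]
  calc _ ≤ C * (1 + t ^ 2) *
        (Real.exp (κ * c ^ 2 / 2 + s * c) * Real.exp (-(κ / 2) * t ^ 2)) := by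
        gcongr
        exact hPC t
    _ = _ := by ring

theorem norm_line_le (c t : ℝ) : ‖(c : ℂ) + t * I‖ ≤ (|c| + 1) * (1 + t ^ 2) := by
  have h := add_abs_mul_add_abs_le (abs_nonneg c) zero_le_one t
  have h1 := norm_ofReal_add_mul_I_le c t
  have : |t| ≤ 1 + t ^ 2 := by nlinarith [sq_abs t, sq_nonneg (|t| - 1), abs_nonneg t]
  nlinarith [abs_nonneg c, mul_nonneg (abs_nonneg c) (sq_nonneg t)]

theorem hasDerivAt_line (c t : ℝ) : HasDerivAt (fun t : ℝ => (c : ℂ) + t * I) I t := by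
  simpa using ((hasDerivAt_id t).ofReal_comp.mul_const I).const_add (c : ℂ)

theorem hasDerivAt_exp_quadratic_line (κ s c t : ℝ) :
    HasDerivAt (fun t : ℝ => cexp (κ * ((c : ℂ) + t * I) ^ 2 / 2 + s * ((c : ℂ) + t * I)))
      (I * (κ * ((c : ℂ) + t * I) + s) *
        cexp (κ * ((c : ℂ) + t * I) ^ 2 / 2 + s * ((c : ℂ) + t * I))) t := by
  have h := hasDerivAt_line c t
  convert ((((h.fun_pow 2).const_mul (κ : ℂ)).div_const 2).fun_add
    (h.const_mul (s : ℂ))).cexp using 1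
  push_cast
  ring

theorem integral_line_mul_exp_quadratic_line {κ : ℝ} (hκ : 0 < κ) (s c : ℝ) :
    ∫ t : ℝ, ((c : ℂ) + t * I) * cexp (κ * ((c : ℂ) + t * I) ^ 2 / 2 + s * ((c : ℂ) + t * I)) =
      -(s / κ) * (Real.sqrt (2 * Real.pi / κ) * cexp (-s ^ 2 / (2 * κ))) := by
  have hκ' : (κ : ℂ) ≠ 0 := by exact_mod_cast hκ.ne'
  have i1 := integrable_mul_exp_quadratic_line hκ s c (P := fun t : ℝ => (c : ℂ) + t * I)
    (by fun_prop) (norm_line_le c)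
  have i0 : Integrable fun t : ℝ =>
      cexp (κ * ((c : ℂ) + t * I) ^ 2 / 2 + s * ((c : ℂ) + t * I)) := by
    simpa using integrable_mul_exp_quadratic_line hκ s c (P := fun _ : ℝ => 1) (C := 1)
      (by fun_prop) (fun t => by simp; positivity)
  have e : ∀ t : ℝ, I * (κ * ((c : ℂ) + t * I) + s) *
        cexp (κ * ((c : ℂ) + t * I) ^ 2 / 2 + s * ((c : ℂ) + t * I)) =
      (I * κ) * (((c : ℂ) + t * I) *
          cexp (κ * ((c : ℂ) + t * I) ^ 2 / 2 + s * ((c : ℂ) + t * I))) +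
        (I * s) * cexp (κ * ((c : ℂ) + t * I) ^ 2 / 2 + s * ((c : ℂ) + t * I)) :=
    fun t => by ring
  have h := integral_eq_zero_of_hasDerivAt_of_integrable
    (fun t => hasDerivAt_exp_quadratic_line κ s c t)
    (by simp_rw [e]; exact (i1.const_mul _).add (i0.const_mul _)) i0
  simp_rw [e] at h
  rw [integral_add (i1.const_mul _) (i0.const_mul _), integral_const_mul, integral_const_mul,
    integral_exp_quadratic_line hκ] at h
  rw [mul_assoc, mul_assoc, ← mul_add] at h
  have h' := (mul_eq_zero.mp h).resolve_left I_ne_zero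
  refine mul_left_cancel₀ hκ' ?_
  rw [eq_neg_of_add_eq_zero_left h']
  field_simp

theorem norm_log_le {w : ℂ} {d : ℝ} (hd : 0 < d) (hw : d ≤ w.re) :
    ‖Complex.log w‖ ≤ ‖w‖ + d⁻¹ + Real.pi := by
  have hdw : d ≤ ‖w‖ := hw.trans (re_le_norm w)
  have hw0 : 0 < ‖w‖ := hd.trans_le hdw
  refine (norm_le_abs_re_add_abs_im _).trans (add_le_add ?_ ?_)
  · rw [log_re, abs_le]
    have h1 := Real.log_le_sub_one_of_pos hw0
    have h2 := Real.log_le_sub_one_of_pos (inv_pos.mpr hw0)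
    rw [Real.log_inv] at h2
    have h3 := inv_anti₀ hd hdw
    have := inv_pos.mpr hd
    constructor <;> linarith
  · rw [log_im]
    exact abs_arg_le_pi w

theorem norm_line_mul_log_le {a b : ℝ} (hab : a < b) (t u : ℝ) :
    ‖((b : ℂ) + u * I) * Complex.log (-((a : ℂ) + t * I) + ((b : ℂ) + u * I))‖ ≤
      (|b| + 1) * ((|a| + |t| + |b| + (b - a)⁻¹ + Real.pi) + 1) * (1 + u ^ 2) := by
  have hd : 0 < b - a := sub_pos.mpr hab
  have hπ := Real.pi_pos
  rw [norm_mul]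
  refine le_trans (mul_le_mul (norm_ofReal_add_mul_I_le b u) ?_ (norm_nonneg _) (by positivity))
    (add_abs_mul_add_abs_le (abs_nonneg b) (by positivity) u)
  refine (norm_log_le hd (by simp)).trans ?_
  have h1 := norm_ofReal_add_mul_I_le b u
  have h2 := norm_ofReal_add_mul_I_le a t
  have h3 := norm_add_le (-((a : ℂ) + t * I)) ((b : ℂ) + u * I)
  rw [norm_neg] at h3
  linarith

theorem sub_le_norm_neg_line_add_line {a b : ℝ} (t u : ℝ) :
    b - a ≤ ‖-((a : ℂ) + t * I) + ((b : ℂ) + u * I)‖ :=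
  le_trans (by simp) (re_le_norm _)

theorem integral_line_mul_log_mul_exp {κ : ℝ} (hκ : 0 < κ) {a b : ℝ} (hab : a < b) (t : ℝ) :
    ∫ u : ℝ, ((b : ℂ) + u * I) * Complex.log (-((a : ℂ) + t * I) + ((b : ℂ) + u * I)) *
        cexp (κ * ((b : ℂ) + u * I) ^ 2 / 2) =
      -(κ : ℂ)⁻¹ * ∫ u : ℝ, (-((a : ℂ) + t * I) + ((b : ℂ) + u * I))⁻¹ *
        cexp (κ * ((b : ℂ) + u * I) ^ 2 / 2) := by
  have hd : 0 < b - a := sub_pos.mpr hab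
  have hκ' : (κ : ℂ) ≠ 0 := by exact_mod_cast hκ.ne'
  have hπ := Real.pi_pos
  have i1 := integrable_mul_exp_quadratic_line hκ 0 b (by fun_prop)
    (norm_line_mul_log_le hab t)
  have i2 := integrable_mul_exp_quadratic_line hκ 0 b (C := (b - a)⁻¹)
    (P := fun u : ℝ => (-((a : ℂ) + t * I) + ((b : ℂ) + u * I))⁻¹) (by fun_prop) (fun u => by
      rw [norm_inv]
      refine (inv_anti₀ hd (sub_le_norm_neg_line_add_line t u)).trans ?_
      exact le_mul_of_one_le_right (by positivity) (by nlinarith))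
  have i3 := integrable_mul_exp_quadratic_line hκ 0 b
    (C := (0 + 1) * ((|a| + |t| + |b| + (b - a)⁻¹ + Real.pi) + 1) + 1)
    (P := fun u : ℝ => Complex.log (-((a : ℂ) + t * I) + ((b : ℂ) + u * I))) (by fun_prop)
    (fun u => by
      refine (norm_log_le hd (by simp)).trans ?_
      have h1 := norm_ofReal_add_mul_I_le b u
      have h2 := norm_ofReal_add_mul_I_le a t
      have h3 := norm_add_le (-((a : ℂ) + t * I)) ((b : ℂ) + u * I)
      rw [norm_neg] at h3
      have h4 : |u| ≤ 1 + u ^ 2 := by nlinarith [sq_abs u, sq_nonneg (|u| - 1), abs_nonneg u]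
      have h5 : 0 ≤ (|a| + |t| + |b| + (b - a)⁻¹ + Real.pi) := by positivity
      nlinarith [mul_nonneg h5 (sq_nonneg u)])
  simp only [ofReal_zero, zero_mul, add_zero] at i1 i2 i3
  have hL : ∀ u : ℝ, HasDerivAt
      (fun u : ℝ => Complex.log (-((a : ℂ) + t * I) + ((b : ℂ) + u * I)))
      (I / (-((a : ℂ) + t * I) + ((b : ℂ) + u * I))) u := fun u =>
    ((hasDerivAt_line b u).const_add _).clog_real (Or.inl (by simp; linarith))
  have hE : ∀ u : ℝ, HasDerivAt (fun u : ℝ => cexp (κ * ((b : ℂ) + u * I) ^ 2 / 2))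
      (I * (κ * ((b : ℂ) + u * I)) * cexp (κ * ((b : ℂ) + u * I) ^ 2 / 2)) u := fun u => by
    simpa using hasDerivAt_exp_quadratic_line κ 0 b u
  have h := integral_mul_deriv_eq_deriv_mul_of_integrable (fun u _ => hL u) (fun u _ => hE u)
    ((i1.const_mul (I * κ)).congr (Filter.Eventually.of_forall fun u => by simp; ring))
    ((i2.const_mul I).congr (Filter.Eventually.of_forall fun u => by simp; ring))
    i3
  have e1 : ∀ u : ℝ, Complex.log (-((a : ℂ) + t * I) + ((b : ℂ) + u * I)) *
      (I * (κ * ((b : ℂ) + u * I)) * cexp (κ * ((b : ℂ) + u * I) ^ 2 / 2)) =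
      (I * κ) * (((b : ℂ) + u * I) * Complex.log (-((a : ℂ) + t * I) + ((b : ℂ) + u * I)) *
        cexp (κ * ((b : ℂ) + u * I) ^ 2 / 2)) := fun u => by ring
  have e2 : ∀ u : ℝ, I / (-((a : ℂ) + t * I) + ((b : ℂ) + u * I)) *
      cexp (κ * ((b : ℂ) + u * I) ^ 2 / 2) =
      I * ((-((a : ℂ) + t * I) + ((b : ℂ) + u * I))⁻¹ *
        cexp (κ * ((b : ℂ) + u * I) ^ 2 / 2)) := fun u => by ring
  simp_rw [e1, e2] at h
  rw [integral_const_mul, integral_const_mul] at h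
  have h' := mul_left_cancel₀ I_ne_zero (h.trans (neg_mul_eq_mul_neg _ _) |> (mul_assoc _ _ _).symm.trans)
  rw [eq_comm, neg_mul, inv_mul_eq_div, ← neg_div, div_eq_iff hκ', ← h', mul_comm]

theorem integral_inv_mul_exp_quadratic_line {κ : ℝ} (hκ : 0 < κ) {b : ℝ} {ξ : ℂ}
    (hξ : ξ.re < b) :
    ∫ u : ℝ, (-ξ + ((b : ℂ) + u * I))⁻¹ * cexp (κ * ((b : ℂ) + u * I) ^ 2 / 2) =
      ∫ s in Set.Ioi (0 : ℝ),
        cexp (s * ξ) * (Real.sqrt (2 * Real.pi / κ) * cexp (-s ^ 2 / (2 * κ))) := by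
  have hre : ∀ u : ℝ, (ξ - ((b : ℂ) + u * I)).re = -(b - ξ.re) := fun u => by simp
  have hd : 0 < b - ξ.re := sub_pos.mpr hξ
  have e1 : ∀ u : ℝ, (-ξ + ((b : ℂ) + u * I))⁻¹ * cexp (κ * ((b : ℂ) + u * I) ^ 2 / 2) =
      ∫ s in Set.Ioi (0 : ℝ), cexp (κ * ((b : ℂ) + u * I) ^ 2 / 2) *
        cexp ((ξ - ((b : ℂ) + u * I)) * s) := fun u => by
    rw [integral_const_mul, integral_exp_mul_complex_Ioi (by rw [hre]; linarith), mul_comm,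
      ofReal_zero, mul_zero, Complex.exp_zero, neg_div, ← div_neg, one_div,
      neg_sub, neg_add_eq_sub]
  have i0 := (integrable_mul_exp_quadratic_line hκ 0 b (P := fun _ : ℝ => 1) (C := 1)
      (by fun_prop) (fun t => by simp; positivity)).norm
  have i1 : Integrable (fun s : ℝ => Real.exp (-(b - ξ.re) * s))
      (volume.restrict (Set.Ioi 0)) := exp_neg_integrableOn_Ioi 0 hd
  have hint : Integrable (Function.uncurry fun (u s : ℝ) =>
      cexp (κ * ((b : ℂ) + u * I) ^ 2 / 2) * cexp ((ξ - ((b : ℂ) + u * I)) * s))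
      (volume.prod (volume.restrict (Set.Ioi 0))) := by
    refine (i0.mul_prod i1).mono' (Measurable.aestronglyMeasurable (by fun_prop))
      (Filter.Eventually.of_forall fun p => le_of_eq ?_)
    simp only [Function.uncurry, norm_mul, ofReal_zero, zero_mul, add_zero, one_mul]
    rw [norm_exp ((ξ - _) * _), re_mul_ofReal, hre]
  simp_rw [e1]
  rw [integral_integral_swap hint]
  refine integral_congr_ae (Filter.Eventually.of_forall fun s => ?_)
  have h := integral_exp_quadratic_line hκ (-s) b
  simp only [ofReal_neg, neg_sq] at h
  simp only
  rw [← h, ← integral_const_mul]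
  refine integral_congr_ae (Filter.Eventually.of_forall fun u => ?_)
  simp only [← Complex.exp_add]
  congr 1
  ring

theorem integral_line_mul_exp_mul_integral_inv_mul_exp {κ μ : ℝ} (hκ : 0 < κ) (hμ : 0 < μ)
    {a b : ℝ} (ha : a < 0) (hab : a < b) :
    ∫ t : ℝ, ((a : ℂ) + t * I) * cexp (μ * ((a : ℂ) + t * I) ^ 2 / 2) *
      ∫ u : ℝ, (-((a : ℂ) + t * I) + ((b : ℂ) + u * I))⁻¹ *
        cexp (κ * ((b : ℂ) + u * I) ^ 2 / 2) =
      -(2 * Real.pi * κ / ((μ + κ) * Real.sqrt (μ * κ)) : ℂ) := by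
  have hκ' : (κ : ℂ) ≠ 0 := by exact_mod_cast hκ.ne'
  have hμ' : (μ : ℂ) ≠ 0 := by exact_mod_cast hμ.ne'
  have hμκ' : (μ + κ : ℂ) ≠ 0 := by exact_mod_cast (add_pos hμ hκ).ne'
  have hs' : (Real.sqrt (μ * κ) : ℂ) ≠ 0 := by
    exact_mod_cast (Real.sqrt_pos.mpr (mul_pos hμ hκ)).ne'
  have e1 : ∀ t : ℝ, ((a : ℂ) + t * I) * cexp (μ * ((a : ℂ) + t * I) ^ 2 / 2) *
      ∫ u : ℝ, (-((a : ℂ) + t * I) + ((b : ℂ) + u * I))⁻¹ *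
        cexp (κ * ((b : ℂ) + u * I) ^ 2 / 2) =
      ∫ s in Set.Ioi (0 : ℝ), ((a : ℂ) + t * I) * cexp (μ * ((a : ℂ) + t * I) ^ 2 / 2) *
        (cexp (s * ((a : ℂ) + t * I)) *
          (Real.sqrt (2 * Real.pi / κ) * cexp (-s ^ 2 / (2 * κ)))) := fun t => by
    rw [integral_const_mul, integral_inv_mul_exp_quadratic_line hκ (by simpa using hab)]
  simp_rw [e1]
  have i0 := (integrable_mul_exp_quadratic_line hμ 0 a (P := fun t : ℝ => (a : ℂ) + t * I)
    (by fun_prop) (norm_line_le a)).norm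
  have i1 : Integrable (fun s : ℝ => Real.exp (-(-a) * s) * Real.sqrt (2 * Real.pi / κ))
      (volume.restrict (Set.Ioi 0)) :=
    Integrable.mul_const (exp_neg_integrableOn_Ioi 0 (neg_pos.mpr ha)) _
  rw [integral_integral_swap]
  · have e2 : ∀ s : ℝ, ∫ t : ℝ, ((a : ℂ) + t * I) * cexp (μ * ((a : ℂ) + t * I) ^ 2 / 2) *
        (cexp (s * ((a : ℂ) + t * I)) *
          (Real.sqrt (2 * Real.pi / κ) * cexp (-s ^ 2 / (2 * κ)))) =
        -(Real.sqrt (2 * Real.pi / κ) * Real.sqrt (2 * Real.pi / μ) / μ) *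
          (s * cexp (-((μ + κ) / (2 * (μ * κ))) * s ^ 2)) := fun s => by
      have h := integral_line_mul_exp_quadratic_line hμ s a
      have e3 : cexp (-((μ + κ) / (2 * (μ * κ))) * s ^ 2) =
          cexp (-s ^ 2 / (2 * μ)) * cexp (-s ^ 2 / (2 * κ)) := by
        rw [← Complex.exp_add]
        congr 1
        field_simp
        ring
      simp_rw [Complex.exp_add] at h
      calc _ = ∫ t : ℝ, (Real.sqrt (2 * Real.pi / κ) * cexp (-s ^ 2 / (2 * κ))) *
            (((a : ℂ) + t * I) * (cexp (μ * ((a : ℂ) + t * I) ^ 2 / 2) *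
              cexp (s * ((a : ℂ) + t * I)))) :=
            integral_congr_ae (Filter.Eventually.of_forall fun t => by simp only; ring)
        _ = _ := by
            rw [integral_const_mul, h, e3]
            ring
    have hsqrt : Real.sqrt (2 * Real.pi / κ) * Real.sqrt (2 * Real.pi / μ) =
        2 * Real.pi / Real.sqrt (μ * κ) := by
      have hπ := Real.pi_pos
      rw [← Real.sqrt_mul (by positivity), show 2 * Real.pi / κ * (2 * Real.pi / μ) =
        (2 * Real.pi) ^ 2 / (μ * κ) by field_simp, Real.sqrt_div (by positivity),
        Real.sqrt_sq (by positivity)]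
    have hp : 0 < ((μ + κ) / (2 * (μ * κ)) : ℂ).re := by
      have : ((μ + κ) / (2 * (μ * κ)) : ℂ) = (((μ + κ) / (2 * (μ * κ)) : ℝ) : ℂ) := by
        push_cast; rfl
      rw [this, ofReal_re]
      positivity
    simp_rw [e2]
    rw [integral_const_mul, integral_mul_cexp_neg_mul_sq hp, ← ofReal_mul, hsqrt]
    push_cast
    field_simp
  · refine (i0.mul_prod i1).mono' (Measurable.aestronglyMeasurable (by fun_prop))
      (Filter.Eventually.of_forall fun p => ?_)
    simp only [Function.uncurry, norm_mul, ofReal_zero, zero_mul, add_zero]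
    have h1 : ‖cexp (-(p.2 : ℂ) ^ 2 / (2 * κ))‖ ≤ 1 := by
      rw [show (-(p.2 : ℂ) ^ 2 / (2 * κ)) = ((-p.2 ^ 2 / (2 * κ) : ℝ) : ℂ) by push_cast; rfl,
        norm_exp_ofReal, Real.exp_le_one_iff]
      exact div_nonpos_of_nonpos_of_nonneg (neg_nonpos.mpr (sq_nonneg _)) (by positivity)
    have h2 : ‖cexp (p.2 * ((a : ℂ) + p.1 * I))‖ = Real.exp (-(-a) * p.2) := by
      rw [norm_exp, re_ofReal_mul]
      simp [mul_comm]
    rw [h2, norm_real, Real.norm_of_nonneg (Real.sqrt_nonneg _)]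
    gcongr
    exact mul_le_of_le_one_right (Real.sqrt_nonneg _) h1

theorem norm_pow_mul_exp_line_le (z : ℂ) (c t : ℝ) (n : ℕ) :
    ‖z ^ (n + 1) * cexp (((n + 1 : ℝ) : ℂ) * ((c : ℂ) + t * I) ^ 2 / 2)‖ ≤
      (‖z‖ * Real.exp (c ^ 2 / 2)) ^ (n + 1) * Real.exp (-(1 / 2) * t ^ 2) := by
  have h := norm_exp_quadratic_line (n + 1) 0 c t
  rw [ofReal_zero, zero_mul, add_zero, zero_mul, add_zero] at h
  rw [norm_mul, norm_pow, h, mul_pow, ← Real.exp_nat_mul, ← mul_assoc]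
  push_cast
  rw [mul_div_assoc]
  gcongr
  nlinarith [sq_nonneg t, mul_nonneg (Nat.cast_nonneg (α := ℝ) n) (sq_nonneg t)]

theorem hasSum_pow_mul_exp_line {z : ℂ} {c : ℝ} (hz : ‖z‖ * Real.exp (c ^ 2 / 2) < 1) (t : ℝ) :
    HasSum (fun n : ℕ => z ^ (n + 1) * cexp (((n + 1 : ℝ) : ℂ) * ((c : ℂ) + t * I) ^ 2 / 2))
      (z / (cexp (-((c : ℂ) + t * I) ^ 2 / 2) - z)) := by
  set q := z * cexp (((c : ℂ) + t * I) ^ 2 / 2) with hq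
  have hq1 : ‖q‖ < 1 := by
    have h := norm_pow_mul_exp_line_le z c t 0
    simp only [zero_add, pow_one, Nat.cast_zero, ofReal_one, one_mul] at h
    refine h.trans_lt (lt_of_le_of_lt (mul_le_of_le_one_right (by positivity) ?_) hz)
    rw [Real.exp_le_one_iff]
    nlinarith [sq_nonneg t]
  have h := (hasSum_geometric_of_norm_lt_one hq1).mul_left q
  have hlim : z / (cexp (-((c : ℂ) + t * I) ^ 2 / 2) - z) = q * (1 - q)⁻¹ := by
    have hne : 1 - q ≠ 0 := fun h0 => by
      rw [← sub_eq_zero.mp h0, norm_one] at hq1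
      exact lt_irrefl _ hq1
    have : cexp (-((c : ℂ) + t * I) ^ 2 / 2) - z =
        cexp (-((c : ℂ) + t * I) ^ 2 / 2) * (1 - q) := by
      rw [hq, mul_sub, mul_one, mul_left_comm, ← Complex.exp_add]
      ring_nf
      simp
    rw [this, hq, ← div_eq_mul_inv, ← div_div]
    congr 1
    rw [div_eq_mul_inv, ← Complex.exp_neg]
    ring_nf
  rw [hlim]
  refine h.congr_fun fun n => ?_
  rw [← pow_succ', hq, mul_pow, ← Complex.exp_nat_mul]
  push_cast
  rw [mul_div_assoc]

theorem summable_pow_succ {r : ℝ} (h0 : 0 ≤ r) (h1 : r < 1) :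
    Summable fun n : ℕ => r ^ (n + 1) :=
  (summable_nat_add_iff 1).mpr (summable_geometric_of_lt_one h0 h1)

theorem summable_pow_succ_mul_pow_succ {r r' : ℝ} (h0 : 0 ≤ r) (h1 : r < 1) (h0' : 0 ≤ r')
    (h1' : r' < 1) : Summable fun p : ℕ × ℕ => r ^ (p.1 + 1) * r' ^ (p.2 + 1) :=
  Summable.mul_of_nonneg (f := fun n : ℕ => r ^ (n + 1)) (g := fun n : ℕ => r' ^ (n + 1))
    (summable_pow_succ h0 h1) (summable_pow_succ h0' h1')
    (fun n => pow_nonneg h0 (n + 1)) fun n => pow_nonneg h0' (n + 1)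

theorem hasSum_pow_mul_integral_mul_exp_line {z : ℂ} {c : ℝ}
    (hz : ‖z‖ * Real.exp (c ^ 2 / 2) < 1) {P : ℝ → ℂ} (hP : Measurable P) {C : ℝ}
    (hPC : ∀ t, ‖P t‖ ≤ C * (1 + t ^ 2)) :
    HasSum (fun n : ℕ => z ^ (n + 1) *
        ∫ t : ℝ, P t * cexp (((n + 1 : ℝ) : ℂ) * ((c : ℂ) + t * I) ^ 2 / 2))
      (∫ t : ℝ, P t * (z / (cexp (-((c : ℂ) + t * I) ^ 2 / 2) - z))) := by
  have hG := (integrable_mul_exp_quadratic_line one_pos 0 0 hP hPC).norm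
  simp only [norm_mul, norm_exp_quadratic_line] at hG
  have hr : 0 ≤ ‖z‖ * Real.exp (c ^ 2 / 2) := by positivity
  simp_rw [← integral_const_mul]
  refine hasSum_integral_of_dominated_convergence
    (fun n t => (‖z‖ * Real.exp (c ^ 2 / 2)) ^ (n + 1) *
      (‖P t‖ * Real.exp (-(1 / 2) * t ^ 2)))
    (fun n => Measurable.aestronglyMeasurable (by fun_prop))
    (fun n => Filter.Eventually.of_forall fun t => ?_)
    (Filter.Eventually.of_forall fun t => (summable_pow_succ hr hz).mul_right _) ?_
    (Filter.Eventually.of_forall fun t => ?_)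
  · rw [mul_left_comm, norm_mul, mul_left_comm]
    exact mul_le_mul_of_nonneg_left (norm_pow_mul_exp_line_le z c t n) (norm_nonneg _)
  · simp_rw [tsum_mul_right]
    refine Integrable.const_mul ?_ _
    simpa using hG
  · refine ((hasSum_pow_mul_exp_line hz t).mul_left (P t)).congr_fun fun n => ?_
    ring

theorem norm_mul_exp_half_sq_lt_one {z : ℂ} (hz0 : 0 < ‖z‖) (hz1 : ‖z‖ < 1) {c : ℝ}
    (hc : |c| < Real.sqrt (-Real.log ‖z‖)) : ‖z‖ * Real.exp (c ^ 2 / 2) < 1 := by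
  have h1 : c ^ 2 < -Real.log ‖z‖ := by
    rw [← sq_abs]
    exact (Real.lt_sqrt (abs_nonneg c)).mp hc
  have h2 := Real.log_neg hz0 hz1
  nth_rewrite 1 [← Real.exp_log hz0]
  rw [← Real.exp_add, Real.exp_lt_one_iff]
  linarith

theorem summable_norm_double_series {z z' : ℂ} (hz1 : ‖z‖ < 1) (hz'1 : ‖z'‖ < 1) :
    Summable fun p : ℕ × ℕ => ‖z ^ (p.1 + 1) * z' ^ (p.2 + 1) /
        (((p.1 + 1 + (p.2 + 1) : ℕ) : ℂ) * (Real.sqrt ((p.1 + 1 : ℝ) * (p.2 + 1)) : ℂ))‖ := by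
  refine Summable.of_nonneg_of_le (fun _ => norm_nonneg _) (fun p => ?_)
    (summable_pow_succ_mul_pow_succ (norm_nonneg z) hz1 (norm_nonneg z') hz'1)
  rw [norm_div, norm_mul, norm_pow, norm_pow]
  refine div_le_self (by positivity) ?_
  rw [norm_mul, norm_natCast, norm_real, Real.norm_of_nonneg (Real.sqrt_nonneg _)]
  refine one_le_mul_of_one_le_of_one_le (by norm_cast; omega) (Real.one_le_sqrt.mpr ?_)
  exact one_le_mul_of_one_le_of_one_le (by simp) (by simp)

theorem norm_pow_mul_integral_inv_mul_exp_le (z : ℂ) {a b : ℝ} (hab : a < b) (t : ℝ) (n : ℕ) :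
    ‖z ^ (n + 1) * ∫ u : ℝ, (-((a : ℂ) + t * I) + ((b : ℂ) + u * I))⁻¹ *
        cexp (((n + 1 : ℝ) : ℂ) * ((b : ℂ) + u * I) ^ 2 / 2)‖ ≤
      (‖z‖ * Real.exp (b ^ 2 / 2)) ^ (n + 1) *
        ((b - a)⁻¹ * ∫ u : ℝ, Real.exp (-(1 / 2) * u ^ 2)) := by
  rw [← integral_const_mul, ← integral_const_mul, ← integral_const_mul]
  refine norm_integral_le_of_norm_le
    (((integrable_exp_neg_mul_sq (by norm_num)).const_mul _).const_mul _)
    (Filter.Eventually.of_forall fun u => ?_)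
  rw [mul_left_comm, norm_mul, mul_left_comm, norm_inv]
  exact mul_le_mul (inv_anti₀ (sub_pos.mpr hab) (sub_le_norm_neg_line_add_line t u))
    (norm_pow_mul_exp_line_le z b u n) (norm_nonneg _) (inv_nonneg.mpr (sub_pos.mpr hab).le)

theorem hasSum_mul_prod {f g : ℕ → ℂ} {x y : ℂ} (hf : HasSum f x) (hg : HasSum g y) :
    HasSum (fun p : ℕ × ℕ => f p.1 * g p.2) (x * y) :=
  hf.mul hg (summable_mul_of_summable_norm hf.summable.norm hg.summable.norm)

theorem hasSum_integral_line_mul_of_norm_le {z : ℂ} {a r M : ℝ}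
    (hz : ‖z‖ * Real.exp (a ^ 2 / 2) < 1) (hr0 : 0 ≤ r) (hr1 : r < 1) {g : ℕ → ℝ → ℂ} {J : ℝ → ℂ}
    (hgm : ∀ n, Measurable (g n)) (hgle : ∀ n t, ‖g n t‖ ≤ r ^ (n + 1) * M)
    (hgsum : ∀ t, HasSum (fun n => g n t) (J t)) :
    HasSum (fun p : ℕ × ℕ => ∫ t : ℝ, (((a : ℂ) + t * I) * (z ^ (p.1 + 1) *
        cexp (((p.1 + 1 : ℝ) : ℂ) * ((a : ℂ) + t * I) ^ 2 / 2))) * g p.2 t)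
      (∫ t : ℝ, ((a : ℂ) + t * I) * (z / (cexp (-((a : ℂ) + t * I) ^ 2 / 2) - z)) * J t) := by
  have hr : 0 ≤ ‖z‖ * Real.exp (a ^ 2 / 2) := by positivity
  have hsum := summable_pow_succ_mul_pow_succ hr hz hr0 hr1
  refine hasSum_integral_of_dominated_convergence
    (fun p t => (‖z‖ * Real.exp (a ^ 2 / 2)) ^ (p.1 + 1) * r ^ (p.2 + 1) *
      (‖(a : ℂ) + t * I‖ * Real.exp (-(1 / 2) * t ^ 2) * M))
    (fun p => ?_) (fun p => Filter.Eventually.of_forall fun t => ?_)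
    (Filter.Eventually.of_forall fun t => hsum.mul_right _) ?_
    (Filter.Eventually.of_forall fun t => ?_)
  · have := hgm p.2
    exact Measurable.aestronglyMeasurable (by fun_prop)
  · rw [norm_mul, norm_mul]
    calc _ ≤ ‖(a : ℂ) + t * I‖ * ((‖z‖ * Real.exp (a ^ 2 / 2)) ^ (p.1 + 1) *
            Real.exp (-(1 / 2) * t ^ 2)) * (r ^ (p.2 + 1) * M) := by
          gcongr
          · exact norm_pow_mul_exp_line_le z a t p.1
          · exact hgle p.2 t
      _ = _ := by ring
  · simp_rw [tsum_mul_right]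
    refine (Integrable.mul_const ?_ M).const_mul _
    have hG := (integrable_mul_exp_quadratic_line one_pos 0 0
      (P := fun t : ℝ => (a : ℂ) + t * I) (by fun_prop) (norm_line_le a)).norm
    simp only [norm_mul, norm_exp_quadratic_line] at hG
    simpa using hG
  · have h1 := (hasSum_pow_mul_exp_line hz t).mul_left ((a : ℂ) + t * I)
    exact hasSum_mul_prod (f := fun n : ℕ => ((a : ℂ) + t * I) *
      (z ^ (n + 1) * cexp (((n + 1 : ℝ) : ℂ) * ((a : ℂ) + t * I) ^ 2 / 2)))
      (g := fun n => g n t) h1 (hgsum t)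

theorem hasSum_integral_line_mul_log {z z' : ℂ} {a b : ℝ} (ha0 : a < 0) (hab : a < b)
    (hz : ‖z‖ * Real.exp (a ^ 2 / 2) < 1) (hz' : ‖z'‖ * Real.exp (b ^ 2 / 2) < 1) :
    HasSum (fun p : ℕ × ℕ => 2 * Real.pi * (z ^ (p.1 + 1) * z' ^ (p.2 + 1) /
        (((p.1 + 1 + (p.2 + 1) : ℕ) : ℂ) * (Real.sqrt ((p.1 + 1 : ℝ) * (p.2 + 1)) : ℂ))))
      (∫ t : ℝ, ((a : ℂ) + t * I) * (z / (cexp (-((a : ℂ) + t * I) ^ 2 / 2) - z)) *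
        ∫ u : ℝ, ((b : ℂ) + u * I) * Complex.log (-((a : ℂ) + t * I) + ((b : ℂ) + u * I)) *
          (z' / (cexp (-((b : ℂ) + u * I) ^ 2 / 2) - z'))) := by
  have hHm : ∀ n : ℕ, Measurable fun t : ℝ =>
      ∫ u : ℝ, (-((a : ℂ) + t * I) + ((b : ℂ) + u * I))⁻¹ *
        cexp (((n + 1 : ℝ) : ℂ) * ((b : ℂ) + u * I) ^ 2 / 2) := fun n => by
    refine (StronglyMeasurable.integral_prod_right (Measurable.stronglyMeasurable ?_)).measurable
    fun_prop
  have key := hasSum_integral_line_mul_of_norm_le hz (by positivity) hz'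
    (g := fun n t => -((n + 1 : ℝ) : ℂ)⁻¹ * (z' ^ (n + 1) *
      ∫ u : ℝ, (-((a : ℂ) + t * I) + ((b : ℂ) + u * I))⁻¹ *
        cexp (((n + 1 : ℝ) : ℂ) * ((b : ℂ) + u * I) ^ 2 / 2)))
    (J := fun t => ∫ u : ℝ, ((b : ℂ) + u * I) *
      Complex.log (-((a : ℂ) + t * I) + ((b : ℂ) + u * I)) *
          (z' / (cexp (-((b : ℂ) + u * I) ^ 2 / 2) - z')))
    (M := (b - a)⁻¹ * ∫ u : ℝ, Real.exp (-(1 / 2) * u ^ 2))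
    (fun n => ((hHm n).const_mul _).const_mul _)
    (fun n t => by
      refine le_trans ?_ (norm_pow_mul_integral_inv_mul_exp_le z' hab t n)
      rw [norm_mul]
      refine mul_le_of_le_one_left (norm_nonneg _) ?_
      rw [norm_neg, norm_inv, norm_real, Real.norm_of_nonneg (by positivity)]
      exact inv_le_one_of_one_le₀ (by simp))
    (fun t => by
      refine (hasSum_pow_mul_integral_mul_exp_line hz' (by fun_prop)
        (norm_line_mul_log_le hab t)).congr_fun fun n => ?_
      rw [integral_line_mul_log_mul_exp (by positivity) hab t, mul_left_comm])
  refine key.congr_fun fun p => ?_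
  have h := integral_line_mul_exp_mul_integral_inv_mul_exp (κ := p.2 + 1) (μ := p.1 + 1)
    (by positivity) (by positivity) ha0 hab
  calc _ = (z ^ (p.1 + 1) * z' ^ (p.2 + 1) * -((p.2 + 1 : ℝ) : ℂ)⁻¹) *
        -(2 * Real.pi * ((p.2 + 1 : ℝ) : ℂ) / ((((p.1 + 1 : ℝ) : ℂ) + ((p.2 + 1 : ℝ) : ℂ)) *
          Real.sqrt ((p.1 + 1 : ℝ) * (p.2 + 1)))) := by
        have hk : ((p.2 : ℂ) + 1) ≠ 0 := Nat.cast_add_one_ne_zero p.2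
        push_cast
        field_simp
    _ = _ := by
        rw [← h, ← integral_const_mul]
        refine integral_congr_ae (Filter.Eventually.of_forall fun t => ?_)
        ring

/-- the double contour integral defining `B(z,z')` over vertical lines
`Re ξ = a`, `Re η = b` (parametrized by `ξ = a + i t`, `η = b + i u`, so that
`dξ/(2πi) = dt/(2π)`) equals the absolutely convergent double series
`(1/(4π)) Σ_{k,k'≥1} z^k z'^{k'} / ((k+k')√(k k'))`. -/
theorem statement0 (z z' : ℂ) (hz0 : 0 < ‖z‖) (hz1 : ‖z‖ < 1)
    (hz'0 : 0 < ‖z'‖) (hz'1 : ‖z'‖ < 1) (a b : ℝ)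
    (ha : -Real.sqrt (-Real.log ‖z‖) < a) (ha0 : a < 0)
    (hb0 : 0 < b) (hb : b < Real.sqrt (-Real.log ‖z'‖)) :
    Summable (fun p : ℕ × ℕ =>
      ‖z ^ (p.1 + 1) * z' ^ (p.2 + 1) /
        (((p.1 + 1 + (p.2 + 1) : ℕ) : ℂ) *
          (Real.sqrt ((p.1 + 1 : ℝ) * (p.2 + 1)) : ℂ))‖) ∧
    z * z' / 2 * (1 / (2 * Real.pi)) ^ 2 *
      ∫ t : ℝ, ∫ u : ℝ,
        (((a : ℂ) + t * Complex.I) * ((b : ℂ) + u * Complex.I) *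
            Complex.log (-((a : ℂ) + t * Complex.I) + ((b : ℂ) + u * Complex.I))) /
          ((Complex.exp (-((a : ℂ) + t * Complex.I) ^ 2 / 2) - z) *
            (Complex.exp (-((b : ℂ) + u * Complex.I) ^ 2 / 2) - z')) =
    (1 / (4 * Real.pi)) *
      ∑' p : ℕ × ℕ, z ^ (p.1 + 1) * z' ^ (p.2 + 1) /
        (((p.1 + 1 + (p.2 + 1) : ℕ) : ℂ) *
          (Real.sqrt ((p.1 + 1 : ℝ) * (p.2 + 1)) : ℂ)) := by
  refine ⟨summable_norm_double_series hz1 hz'1, ?_⟩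
  have h := (hasSum_integral_line_mul_log ha0 (ha0.trans hb0)
    (norm_mul_exp_half_sq_lt_one hz0 hz1 (c := a) (by rw [abs_of_neg ha0]; linarith))
    (norm_mul_exp_half_sq_lt_one hz'0 hz'1 (c := b) (by rwa [abs_of_pos hb0]))).tsum_eq
  rw [tsum_mul_left] at h
  have e : z * z' * (∫ t : ℝ, ∫ u : ℝ,
        (((a : ℂ) + t * Complex.I) * ((b : ℂ) + u * Complex.I) *
            Complex.log (-((a : ℂ) + t * Complex.I) + ((b : ℂ) + u * Complex.I))) /
          ((Complex.exp (-((a : ℂ) + t * Complex.I) ^ 2 / 2) - z) *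
            (Complex.exp (-((b : ℂ) + u * Complex.I) ^ 2 / 2) - z'))) =
      ∫ t : ℝ, ((a : ℂ) + t * I) * (z / (cexp (-((a : ℂ) + t * I) ^ 2 / 2) - z)) *
        ∫ u : ℝ, ((b : ℂ) + u * I) * Complex.log (-((a : ℂ) + t * I) + ((b : ℂ) + u * I)) *
          (z' / (cexp (-((b : ℂ) + u * I) ^ 2 / 2) - z')) := by
    simp_rw [← integral_const_mul]
    congr 1 with t
    congr 1 with u
    simp only [div_eq_mul_inv, mul_inv]
    ring
  have hπ : (Real.pi : ℂ) ≠ 0 := by exact_mod_cast Real.pi_ne_zero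
  rw [div_mul_eq_mul_div, div_mul_eq_mul_div, mul_right_comm, e, ← h]
  field_simp
  ring
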